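/- Let (v,u,χ,θ) ∈ X(0,T;m₁,m₂,m₃,N) be a solution to the initial-boundary value problem on [0,1]×[0,T]. Then there exist positive constants C₁ and C₂, depending only on β, V₀ and M₀, such that min_{x∈[0,1]} θ(x,t) ≥ C₁ − C₂ W(t) for all t ∈ [0,T], where W(t) := ∫₀¹ (θ^β θ_x²/(vθ²) + χ^α u_x²/(vθ) + vμ²/θ) dx. -/

import Mathlib

open MeasureTheory Set

noncomputable section

/-- Partial derivative in the spatial variable `x` (second argument). -/
def pdx (f : ℝ → ℝ → ℝ) : ℝ → ℝ → ℝ := fun t x => deriv (f t) x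

/-- Partial derivative in the time variable `t` (first argument). -/
def pdt (f : ℝ → ℝ → ℝ) : ℝ → ℝ → ℝ := fun t x => deriv (fun s => f s x) t

/-- Square of the `L²(0,1)` norm. -/
def L2sq (g : ℝ → ℝ) : ℝ := ∫ x in (0:ℝ)..1, (g x) ^ 2

/-- Square of the `H¹(0,1)` norm. -/
def H1sq (g : ℝ → ℝ) : ℝ := L2sq g + L2sq (deriv g)

/-- Square of the `H²(0,1)` norm. -/
def H2sq (g : ℝ → ℝ) : ℝ := H1sq g + L2sq (deriv (deriv g))

/-- Square of the `H³(0,1)` norm. -/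
def H3sq (g : ℝ → ℝ) : ℝ := H2sq g + L2sq (deriv (deriv (deriv g)))

/-- `L¹(0,1)` norm. -/
def L1norm (g : ℝ → ℝ) : ℝ := ∫ x in (0:ℝ)..1, |g x|

/-- `L^∞([0,1])` norm (for continuous functions). -/
def LinfNorm (g : ℝ → ℝ) : ℝ := sSup ((fun x => |g x|) '' Icc (0:ℝ) 1)

/-- `Φ(s) = s - log s - 1`. -/
def Phi (s : ℝ) : ℝ := s - Real.log s - 1

/-- A (classical) strong solution of the 1D compressible Navier–Stokes/Allen–Cahn
system in Lagrangian coordinates on `[0,1] × S`, with viscosity `η(χ) = χ^α`,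
heat conductivity `κ(θ) = θ^β`, the natural boundary conditions, and the
normalisation of the initial data at time `t = 0`. -/
structure NSAC (α β : ℝ) (S : Set ℝ) where
  v : ℝ → ℝ → ℝ
  u : ℝ → ℝ → ℝ
  χ : ℝ → ℝ → ℝ
  θ : ℝ → ℝ → ℝ
  μ : ℝ → ℝ → ℝ
  smooth_v : ContDiff ℝ (⊤ : ℕ∞) (fun p : ℝ × ℝ => v p.1 p.2)
  smooth_u : ContDiff ℝ (⊤ : ℕ∞) (fun p : ℝ × ℝ => u p.1 p.2)
  smooth_χ : ContDiff ℝ (⊤ : ℕ∞) (fun p : ℝ × ℝ => χ p.1 p.2)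
  smooth_θ : ContDiff ℝ (⊤ : ℕ∞) (fun p : ℝ × ℝ => θ p.1 p.2)
  vpos : ∀ t ∈ S, ∀ x ∈ Icc (0:ℝ) 1, 0 < v t x
  θpos : ∀ t ∈ S, ∀ x ∈ Icc (0:ℝ) 1, 0 < θ t x
  eq_mass : ∀ t ∈ S, ∀ x ∈ Icc (0:ℝ) 1, pdt v t x = pdx u t x
  eq_mom : ∀ t ∈ S, ∀ x ∈ Icc (0:ℝ) 1,
      pdt u t x + pdx (fun t x => θ t x / v t x) t x
        = pdx (fun t x => (χ t x) ^ α * pdx u t x / v t x) t x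
          - (1 / 2) * pdx (fun t x => (pdx χ t x) ^ 2 / (v t x) ^ 2) t x
  eq_phase : ∀ t ∈ S, ∀ x ∈ Icc (0:ℝ) 1, pdt χ t x = -(v t x * μ t x)
  eq_mu : ∀ t ∈ S, ∀ x ∈ Icc (0:ℝ) 1,
      μ t x = -(pdx (fun t x => pdx χ t x / v t x) t x) + ((χ t x) ^ 3 - χ t x)
  eq_temp : ∀ t ∈ S, ∀ x ∈ Icc (0:ℝ) 1,
      pdt θ t x + (θ t x / v t x) * pdx u t x
        = pdx (fun t x => (θ t x) ^ β * pdx θ t x / v t x) t x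
          + (χ t x) ^ α * (pdx u t x) ^ 2 / v t x + v t x * (μ t x) ^ 2
  bc_u : ∀ t ∈ S, u t 0 = 0 ∧ u t 1 = 0
  bc_χ : ∀ t ∈ S, pdx χ t 0 = 0 ∧ pdx χ t 1 = 0
  bc_θ : ∀ t ∈ S, pdx θ t 0 = 0 ∧ pdx θ t 1 = 0
  norm_v0 : (∫ x in (0:ℝ)..1, v 0 x) = 1
  norm_e0 : (∫ x in (0:ℝ)..1,
      (θ 0 x + (u 0 x) ^ 2 / 2 + ((χ 0 x) ^ 2 - 1) ^ 2 / 4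
        + (pdx χ 0 x) ^ 2 / (2 * v 0 x))) = 1

/-- Membership in the class `X(0,T; m₁, m₂, m₃, N)`. -/
structure XClass (α β T m₁ m₂ m₃ N : ℝ) extends NSAC α β (Icc 0 T) where
  m₁pos : 0 < m₁
  m₂pos : 0 < m₂
  m₃pos : 0 < m₃
  Npos : 0 < N
  lb_v : ∀ t ∈ Icc (0:ℝ) T, ∀ x ∈ Icc (0:ℝ) 1, m₁ ≤ v t x
  lb_χ : ∀ t ∈ Icc (0:ℝ) T, ∀ x ∈ Icc (0:ℝ) 1, m₂ ≤ χ t x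
  lb_θ : ∀ t ∈ Icc (0:ℝ) T, ∀ x ∈ Icc (0:ℝ) 1, m₃ ≤ θ t x
  bound_E : ∀ t ∈ Icc (0:ℝ) T,
      H1sq (fun x => pdx v t x) + H1sq (fun x => pdx u t x)
        + H1sq (fun x => pdx χ t x) + H1sq (fun x => pdx θ t x)
        + (∫ τ in (0:ℝ)..T, L2sq (fun x => pdt χ τ x)) ≤ N ^ 2

/-- The dissipation functional `W(t)`. -/
def Wdiss {α β : ℝ} {S : Set ℝ} (sol : NSAC α β S) (t : ℝ) : ℝ :=
  ∫ x in (0:ℝ)..1,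
    ((sol.θ t x) ^ β * (pdx sol.θ t x) ^ 2 / (sol.v t x * (sol.θ t x) ^ 2)
      + (sol.χ t x) ^ α * (pdx sol.u t x) ^ 2 / (sol.v t x * sol.θ t x)
      + sol.v t x * (sol.μ t x) ^ 2 / sol.θ t x)

/-- The initial energy `E₀`. -/
def E0 {α β : ℝ} {S : Set ℝ} (sol : NSAC α β S) : ℝ :=
  ∫ x in (0:ℝ)..1,
    ((sol.u 0 x) ^ 2 / 2 + ((sol.χ 0 x) ^ 2 - 1) ^ 2 / 4
      + (pdx sol.χ 0 x) ^ 2 / (2 * sol.v 0 x) + Phi (sol.v 0 x) + Phi (sol.θ 0 x))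

/-- The assumptions on the initial data, with constants `V₀`, `M₀`. -/
def InitData {α β : ℝ} {S : Set ℝ} (sol : NSAC α β S) (V₀ M₀ : ℝ) : Prop :=
  (∀ x ∈ Icc (0:ℝ) 1, V₀ ≤ sol.v 0 x) ∧
  (∀ x ∈ Icc (0:ℝ) 1, V₀ ≤ sol.χ 0 x ∧ sol.χ 0 x ≤ 1) ∧
  (∀ x ∈ Icc (0:ℝ) 1, V₀ ≤ sol.θ 0 x) ∧
  Real.sqrt (H2sq (sol.v 0) + H2sq (sol.u 0) + H2sq (sol.θ 0))
    + Real.sqrt (H3sq (sol.χ 0)) ≤ M₀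

/-- `H(m₁,m₂,m₃,N) = (1 + m₁⁻¹ + m₂⁻¹ + m₃⁻¹ + N)^8`. -/
def Hq (m₁ m₂ m₃ N : ℝ) : ℝ := (1 + m₁⁻¹ + m₂⁻¹ + m₃⁻¹ + N) ^ 8

/-- `1/η(χ) = (χ^α)⁻¹`. -/
def etaInv {α β : ℝ} {S : Set ℝ} (sol : NSAC α β S) : ℝ → ℝ → ℝ :=
  fun t x => ((sol.χ t x) ^ α)⁻¹

/-- The auxiliary function `g` in the representation of the specific volume. -/
def gfun {α β : ℝ} {S : Set ℝ} (sol : NSAC α β S) : ℝ → ℝ → ℝ := fun t x =>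
  -(sol.u t x * pdt (etaInv sol) t x
    + (sol.θ t x / sol.v t x) * pdx (etaInv sol) t x
    + ((pdx sol.χ t x) ^ 2 / (2 * (sol.v t x) ^ 2)) * pdx (etaInv sol) t x
    + pdx (fun t x => (sol.χ t x) ^ α) t x * pdx sol.u t x
        / ((sol.χ t x) ^ α * sol.v t x))

/-- The function `B(t)` in the representation of the specific volume. -/
def Bfun {α β : ℝ} {S : Set ℝ} (sol : NSAC α β S) : ℝ → ℝ := fun t =>
  Real.exp (-(∫ τ in (0:ℝ)..t, ∫ x in (0:ℝ)..1,
    ((sol.θ τ x + (sol.u τ x) ^ 2) / (sol.χ τ x) ^ α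
      + (pdx sol.χ τ x) ^ 2 / (2 * (sol.χ τ x) ^ α * sol.v τ x))))

/-- The function `D(x,t)` in the representation of the specific volume
(depending on the choice `a₀` of intermediate points). -/
def Dfun {α β : ℝ} {S : Set ℝ} (sol : NSAC α β S) (a₀ : ℝ → ℝ) : ℝ → ℝ → ℝ :=
  fun t x =>
    sol.v 0 x * Real.exp
      ((∫ y in (a₀ t)..x, sol.u t y / (sol.χ t y) ^ α)
        - (∫ y in (0:ℝ)..x, sol.u 0 y / (sol.χ 0 y) ^ α)
        + ∫ z in (0:ℝ)..1, sol.v 0 z * ∫ y in (0:ℝ)..z, sol.u 0 y / (sol.χ 0 y) ^ α)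

/-- The function `J(x,t)` in the representation of the specific volume. -/
def Jfun {α β : ℝ} {S : Set ℝ} (sol : NSAC α β S) : ℝ → ℝ → ℝ := fun t x =>
  sol.θ t x / ((sol.χ t x) ^ α * sol.v t x)
    + (pdx sol.χ t x) ^ 2 / (2 * (sol.χ t x) ^ α * (sol.v t x) ^ 2)
    + (∫ y in (0:ℝ)..x, gfun sol t y)
    - ∫ z in (0:ℝ)..1, sol.v t z * ∫ y in (0:ℝ)..z, gfun sol t y

/-- `χ_x / v`. -/
def qxv {α β : ℝ} {S : Set ℝ} (sol : NSAC α β S) : ℝ → ℝ → ℝ :=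
  fun t x => pdx sol.χ t x / sol.v t x

/-- `χ_t / v`. -/
def qtv {α β : ℝ} {S : Set ℝ} (sol : NSAC α β S) : ℝ → ℝ → ℝ :=
  fun t x => pdt sol.χ t x / sol.v t x

section Calculus

theorem hasDerivAt_pdx {f : ℝ → ℝ → ℝ}
    (hf : ContDiff ℝ (⊤ : ℕ∞) (fun p : ℝ × ℝ => f p.1 p.2)) (t x : ℝ) :
    HasDerivAt (f t) (pdx f t x) x := by
  have hd : Differentiable ℝ (fun p : ℝ × ℝ => f p.1 p.2) := hf.differentiable (by simp)
  have : Differentiable ℝ (f t) :=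
    hd.comp (g := fun p : ℝ × ℝ => f p.1 p.2) (f := fun y : ℝ => (t, y)) (by fun_prop)
  exact (this x).hasDerivAt

theorem hasDerivAt_pdt {f : ℝ → ℝ → ℝ}
    (hf : ContDiff ℝ (⊤ : ℕ∞) (fun p : ℝ × ℝ => f p.1 p.2)) (t x : ℝ) :
    HasDerivAt (fun s => f s x) (pdt f t x) t := by
  have hd : Differentiable ℝ (fun p : ℝ × ℝ => f p.1 p.2) := hf.differentiable (by simp)
  have : Differentiable ℝ (fun s => f s x) :=
    hd.comp (g := fun p : ℝ × ℝ => f p.1 p.2) (f := fun s : ℝ => (s, x)) (by fun_prop)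
  exact (this t).hasDerivAt

theorem contDiff_pdx {f : ℝ → ℝ → ℝ}
    (hf : ContDiff ℝ (⊤ : ℕ∞) (fun p : ℝ × ℝ => f p.1 p.2)) :
    ContDiff ℝ (⊤ : ℕ∞) (fun p : ℝ × ℝ => pdx f p.1 p.2) := by
  have hd : Differentiable ℝ (fun p : ℝ × ℝ => f p.1 p.2) := hf.differentiable (by simp)
  have h : (fun p : ℝ × ℝ => pdx f p.1 p.2)
      = fun p => fderiv ℝ (fun p : ℝ × ℝ => f p.1 p.2) p (0, 1) := by
    funext p
    exact ((hd (p.1, p.2)).hasFDerivAt.comp_hasDerivAt (f := fun y : ℝ => (p.1, y)) p.2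
      ((hasDerivAt_const p.2 p.1).prodMk (hasDerivAt_id p.2))).deriv
  rw [h]
  exact (hf.fderiv_right (by simp)).clm_apply contDiff_const

theorem contDiff_pdt {f : ℝ → ℝ → ℝ}
    (hf : ContDiff ℝ (⊤ : ℕ∞) (fun p : ℝ × ℝ => f p.1 p.2)) :
    ContDiff ℝ (⊤ : ℕ∞) (fun p : ℝ × ℝ => pdt f p.1 p.2) := by
  have hd : Differentiable ℝ (fun p : ℝ × ℝ => f p.1 p.2) := hf.differentiable (by simp)
  have h : (fun p : ℝ × ℝ => pdt f p.1 p.2)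
      = fun p => fderiv ℝ (fun p : ℝ × ℝ => f p.1 p.2) p (1, 0) := by
    funext p
    exact ((hd (p.1, p.2)).hasFDerivAt.comp_hasDerivAt (f := fun s : ℝ => (s, p.2)) p.1
      ((hasDerivAt_id p.1).prodMk (hasDerivAt_const p.1 p.2))).deriv
  rw [h]
  exact (hf.fderiv_right (by simp)).clm_apply contDiff_const

theorem continuous_slice {f : ℝ → ℝ → ℝ}
    (hf : ContDiff ℝ (⊤ : ℕ∞) (fun p : ℝ × ℝ => f p.1 p.2)) (t : ℝ) : Continuous (f t) :=
  hf.continuous.comp (g := fun p : ℝ × ℝ => f p.1 p.2) (f := fun y : ℝ => (t, y))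
    (by fun_prop)

/-- Fundamental theorem of calculus in time for spatial integrals over `[0,1]`. -/
theorem integral_sub_integral_eq_integral_integral {f g : ℝ → ℝ → ℝ} {t : ℝ} (ht : 0 ≤ t)
    (hfg : ∀ s ∈ Icc (0:ℝ) t, ∀ x ∈ Icc (0:ℝ) 1, HasDerivAt (fun s => f s x) (g s x) s)
    (hg : ContinuousOn (fun p : ℝ × ℝ => g p.1 p.2) (Icc (0:ℝ) t ×ˢ Icc (0:ℝ) 1))
    (hft : ContinuousOn (f t) (Icc 0 1)) (hf0 : ContinuousOn (f 0) (Icc 0 1)) :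
    (∫ x in (0:ℝ)..1, f t x) - (∫ x in (0:ℝ)..1, f 0 x)
      = ∫ s in (0:ℝ)..t, ∫ x in (0:ℝ)..1, g s x := by
  have hint : IntegrableOn g.uncurry (uIoc 0 t ×ˢ uIoc (0:ℝ) 1) := by
    rw [uIoc_of_le ht, uIoc_of_le zero_le_one]
    have h : IntegrableOn g.uncurry (Icc (0:ℝ) t ×ˢ Icc (0:ℝ) 1) :=
      hg.integrableOn_compact (isCompact_Icc.prod isCompact_Icc)
    exact h.mono_set (prod_mono Ioc_subset_Icc_self Ioc_subset_Icc_self)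
  rw [intervalIntegral_intervalIntegral_swap hint,
    ← intervalIntegral.integral_sub (hft.intervalIntegrable_of_Icc zero_le_one)
      (hf0.intervalIntegrable_of_Icc zero_le_one)]
  refine intervalIntegral.integral_congr fun x hx => ?_
  rw [uIcc_of_le zero_le_one] at hx
  refine (intervalIntegral.integral_eq_sub_of_hasDerivAt (f := fun s => f s x) ?_ ?_).symm
  · intro s hs
    rw [uIcc_of_le ht] at hs
    exact hfg s hs x hx
  · refine ContinuousOn.intervalIntegrable_of_Icc ht ?_
    exact hg.comp (f := fun s : ℝ => (s, x)) (by fun_prop) fun s hs => ⟨hs, hx⟩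

/-- The oscillation of a function on `[0,1]` is at most the integral of any majorant of
the absolute value of its derivative. -/
theorem sub_le_integral_of_abs_deriv_le {f f' φ : ℝ → ℝ}
    (hf : ∀ x ∈ Icc (0:ℝ) 1, HasDerivAt f (f' x) x)
    (hφ : ContinuousOn φ (Icc 0 1)) (hle : ∀ x ∈ Icc (0:ℝ) 1, |f' x| ≤ φ x)
    {x y : ℝ} (hx : x ∈ Icc (0:ℝ) 1) (hy : y ∈ Icc (0:ℝ) 1) :
    f y - f x ≤ ∫ z in (0:ℝ)..1, φ z := by
  have key : ∀ h h' : ℝ → ℝ, (∀ x ∈ Icc (0:ℝ) 1, HasDerivAt h (h' x) x) →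
      (∀ x ∈ Icc (0:ℝ) 1, h' x ≤ φ x) → ∀ a ∈ Icc (0:ℝ) 1, ∀ b ∈ Icc (0:ℝ) 1, a ≤ b →
      h b - h a ≤ ∫ z in (0:ℝ)..1, φ z := by
    intro h h' hh hh' a ha b hb hab
    have hsub : Icc a b ⊆ Icc (0:ℝ) 1 := Icc_subset_Icc ha.1 hb.2
    have h1 : h b - h a ≤ ∫ z in a..b, φ z :=
      intervalIntegral.sub_le_integral_of_hasDeriv_right_of_le hab
        (fun z hz => (hh z (hsub hz)).continuousAt.continuousWithinAt)
        (fun z hz => (hh z (hsub (Ioo_subset_Icc_self hz))).hasDerivWithinAt)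
        ((hφ.mono hsub).integrableOn_compact isCompact_Icc)
        (fun z hz => hh' z (hsub (Ioo_subset_Icc_self hz)))
    refine h1.trans (intervalIntegral.integral_mono_interval ha.1 hab hb.2 ?_
      (hφ.intervalIntegrable_of_Icc zero_le_one))
    refine (ae_restrict_iff' measurableSet_Ioc).2 (Filter.Eventually.of_forall fun z hz => ?_)
    exact (abs_nonneg _).trans (hle z (Ioc_subset_Icc_self hz))
  rcases le_total x y with hxy | hyx
  · exact key f f' hf (fun z hz => (le_abs_self _).trans (hle z hz)) x hx y hy hxy
  · have := key (fun z => -f z) (fun z => -f' z) (fun z hz => (hf z hz).neg)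
      (fun z hz => (neg_le_abs _).trans (hle z hz)) y hy x hx hyx
    linarith

end Calculus

namespace NSAC

variable {α β T : ℝ}

/-- Conservation of mass. -/
theorem integral_v_eq_one (sol : NSAC α β (Icc 0 T)) {t : ℝ} (ht : t ∈ Icc (0:ℝ) T) :
    (∫ x in (0:ℝ)..1, sol.v t x) = 1 := by
  have h := integral_sub_integral_eq_integral_integral (f := sol.v) (g := pdt sol.v) ht.1
    (fun s _ x _ => hasDerivAt_pdt sol.smooth_v s x)
    (contDiff_pdt sol.smooth_v).continuous.continuousOn
    (continuous_slice sol.smooth_v t).continuousOn (continuous_slice sol.smooth_v 0).continuousOn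
  have hz : ∀ s ∈ uIcc (0:ℝ) t, (∫ x in (0:ℝ)..1, pdt sol.v s x) = 0 := by
    intro s hs
    rw [uIcc_of_le ht.1] at hs
    have hsT : s ∈ Icc (0:ℝ) T := ⟨hs.1, hs.2.trans ht.2⟩
    have hcongr : (∫ x in (0:ℝ)..1, pdt sol.v s x) = ∫ x in (0:ℝ)..1, pdx sol.u s x :=
      intervalIntegral.integral_congr fun x hx =>
        sol.eq_mass s hsT x (by rwa [uIcc_of_le zero_le_one] at hx)
    rw [hcongr, intervalIntegral.integral_eq_sub_of_hasDerivAt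
      (fun x _ => hasDerivAt_pdx sol.smooth_u s x)
      ((continuous_slice (contDiff_pdx sol.smooth_u) s).intervalIntegrable 0 1),
      (sol.bc_u s hsT).1, (sol.bc_u s hsT).2, sub_zero]
  rw [intervalIntegral.integral_congr hz, sol.norm_v0] at h
  simp only [intervalIntegral.integral_zero] at h
  linarith

/-- The entropy production rate is nonnegative. -/
theorem entropy_production_nonneg (sol : NSAC α β (Icc 0 T)) {t : ℝ} (ht : t ∈ Icc (0:ℝ) T)
    (hχ : ∀ x ∈ Icc (0:ℝ) 1, 0 < sol.χ t x) :
    0 ≤ ∫ x in (0:ℝ)..1, (pdt sol.θ t x / sol.θ t x + pdt sol.v t x / sol.v t x) := by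
  have hθ := sol.θpos t ht
  have hv := sol.vpos t ht
  set F : ℝ → ℝ := fun x => sol.θ t x ^ β * pdx sol.θ t x / sol.v t x with hF
  have hFd : ∀ x ∈ Icc (0:ℝ) 1, HasDerivAt F (deriv F x) x := fun x hx =>
    ((((hasDerivAt_pdx sol.smooth_θ t x).differentiableAt.rpow_const
      (Or.inl (hθ x hx).ne')).mul
      (hasDerivAt_pdx (contDiff_pdx sol.smooth_θ) t x).differentiableAt).div
      (hasDerivAt_pdx sol.smooth_v t x).differentiableAt (hv x hx).ne').hasDerivAt
  have hquot : ∀ x ∈ Icc (0:ℝ) 1, HasDerivAt (fun x => F x / sol.θ t x)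
      ((deriv F x * sol.θ t x - F x * pdx sol.θ t x) / sol.θ t x ^ 2) x := fun x hx =>
    (hFd x hx).div (hasDerivAt_pdx sol.smooth_θ t x) (hθ x hx).ne'
  have hcont : ContinuousOn
      (fun x => pdt sol.θ t x / sol.θ t x + pdt sol.v t x / sol.v t x) (Icc 0 1) :=
    ((continuous_slice (contDiff_pdt sol.smooth_θ) t).continuousOn.div
      (continuous_slice sol.smooth_θ t).continuousOn fun x hx => (hθ x hx).ne').add
      ((continuous_slice (contDiff_pdt sol.smooth_v) t).continuousOn.div
      (continuous_slice sol.smooth_v t).continuousOn fun x hx => (hv x hx).ne')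
  have key := intervalIntegral.sub_le_integral_of_hasDeriv_right_of_le zero_le_one
    (fun z hz => (hquot z hz).continuousAt.continuousWithinAt)
    (fun z hz => (hquot z (Ioo_subset_Icc_self hz)).hasDerivWithinAt)
    (hcont.integrableOn_compact isCompact_Icc) ?_
  · simpa [hF, (sol.bc_θ t ht).1, (sol.bc_θ t ht).2] using key
  intro x hx
  have hx := Ioo_subset_Icc_self hx
  have hθx := hθ x hx
  have hvx := hv x hx
  have htemp := sol.eq_temp t ht x hx
  have hFx : pdx (fun t x => sol.θ t x ^ β * pdx sol.θ t x / sol.v t x) t x = deriv F x := rfl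
  rw [hFx] at htemp
  have hχα : 0 < sol.χ t x ^ α := Real.rpow_pos_of_pos (hχ x hx) α
  have hθβ : 0 < sol.θ t x ^ β := Real.rpow_pos_of_pos hθx β
  have hsum : pdt sol.θ t x / sol.θ t x + pdt sol.v t x / sol.v t x
      - (deriv F x * sol.θ t x - F x * pdx sol.θ t x) / sol.θ t x ^ 2
      = sol.θ t x ^ β * pdx sol.θ t x ^ 2 / (sol.v t x * sol.θ t x ^ 2)
        + sol.χ t x ^ α * pdx sol.u t x ^ 2 / (sol.v t x * sol.θ t x)
        + sol.v t x * sol.μ t x ^ 2 / sol.θ t x := by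
    rw [sol.eq_mass t ht x hx, eq_sub_of_add_eq htemp]
    simp only [hF]
    field_simp
    ring
  have hnn : 0 ≤ sol.θ t x ^ β * pdx sol.θ t x ^ 2 / (sol.v t x * sol.θ t x ^ 2)
        + sol.χ t x ^ α * pdx sol.u t x ^ 2 / (sol.v t x * sol.θ t x)
        + sol.v t x * sol.μ t x ^ 2 / sol.θ t x := by positivity
  linarith

/-- The entropy is nondecreasing in comparison with its initial value. -/
theorem entropy_initial_le (sol : NSAC α β (Icc 0 T))
    (hχ : ∀ s ∈ Icc (0:ℝ) T, ∀ x ∈ Icc (0:ℝ) 1, 0 < sol.χ s x) {t : ℝ} (ht : t ∈ Icc (0:ℝ) T) :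
    (∫ x in (0:ℝ)..1, (Real.log (sol.θ 0 x) + Real.log (sol.v 0 x)))
      ≤ ∫ x in (0:ℝ)..1, (Real.log (sol.θ t x) + Real.log (sol.v t x)) := by
  have hsub : ∀ s ∈ Icc (0:ℝ) t, s ∈ Icc (0:ℝ) T := fun s hs => ⟨hs.1, hs.2.trans ht.2⟩
  have hc : ∀ s ∈ Icc (0:ℝ) T,
      ContinuousOn (fun x => Real.log (sol.θ s x) + Real.log (sol.v s x)) (Icc 0 1) :=
    fun s hs => ((continuous_slice sol.smooth_θ s).continuousOn.log
        fun x hx => (sol.θpos s hs x hx).ne').add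
      ((continuous_slice sol.smooth_v s).continuousOn.log fun x hx => (sol.vpos s hs x hx).ne')
  have h := integral_sub_integral_eq_integral_integral
    (f := fun s x => Real.log (sol.θ s x) + Real.log (sol.v s x))
    (g := fun s x => pdt sol.θ s x / sol.θ s x + pdt sol.v s x / sol.v s x) ht.1
    (fun s hs x hx =>
      ((hasDerivAt_pdt sol.smooth_θ s x).log (sol.θpos s (hsub s hs) x hx).ne').add
        ((hasDerivAt_pdt sol.smooth_v s x).log (sol.vpos s (hsub s hs) x hx).ne'))
    (((contDiff_pdt sol.smooth_θ).continuous.continuousOn.div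
        sol.smooth_θ.continuous.continuousOn
        fun p hp => (sol.θpos p.1 (hsub _ hp.1) p.2 hp.2).ne').add
      ((contDiff_pdt sol.smooth_v).continuous.continuousOn.div
        sol.smooth_v.continuous.continuousOn
        fun p hp => (sol.vpos p.1 (hsub _ hp.1) p.2 hp.2).ne'))
    (hc t ht) (hc 0 ⟨le_rfl, ht.1.trans ht.2⟩)
  have hnn := intervalIntegral.integral_nonneg (μ := volume) ht.1 fun s hs =>
    sol.entropy_production_nonneg (hsub s hs) (hχ s (hsub s hs))
  linarith

/-- At every time the temperature is at least `V₀² / 2` somewhere. -/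
theorem exists_le_temperature (sol : NSAC α β (Icc 0 T))
    (hχ : ∀ s ∈ Icc (0:ℝ) T, ∀ x ∈ Icc (0:ℝ) 1, 0 < sol.χ s x) {V₀ : ℝ} (hV₀ : 0 < V₀)
    (hv₀ : ∀ x ∈ Icc (0:ℝ) 1, V₀ ≤ sol.v 0 x) (hθ₀ : ∀ x ∈ Icc (0:ℝ) 1, V₀ ≤ sol.θ 0 x)
    {t : ℝ} (ht : t ∈ Icc (0:ℝ) T) :
    ∃ x ∈ Icc (0:ℝ) 1, V₀ ^ 2 / 2 ≤ sol.θ t x := by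
  by_contra! hlt
  have hc : ∀ s ∈ Icc (0:ℝ) T, IntervalIntegrable
      (fun x => Real.log (sol.θ s x) + Real.log (sol.v s x)) volume 0 1 :=
    fun s hs => (((continuous_slice sol.smooth_θ s).continuousOn.log
        fun x hx => (sol.θpos s hs x hx).ne').add
      ((continuous_slice sol.smooth_v s).continuousOn.log
        fun x hx => (sol.vpos s hs x hx).ne')).intervalIntegrable_of_Icc zero_le_one
  have hlow : Real.log V₀ + Real.log V₀
      ≤ ∫ x in (0:ℝ)..1, (Real.log (sol.θ 0 x) + Real.log (sol.v 0 x)) := by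
    have := intervalIntegral.integral_mono_on zero_le_one
      (intervalIntegrable_const (μ := volume) (c := Real.log V₀ + Real.log V₀))
      (hc 0 ⟨le_rfl, ht.1.trans ht.2⟩) fun x hx =>
        add_le_add (Real.log_le_log hV₀ (hθ₀ x hx)) (Real.log_le_log hV₀ (hv₀ x hx))
    simpa using this
  have hvint : IntervalIntegrable (sol.v t) volume 0 1 :=
    (continuous_slice sol.smooth_v t).intervalIntegrable 0 1
  have hup : (∫ x in (0:ℝ)..1, (Real.log (sol.θ t x) + Real.log (sol.v t x)))
      ≤ Real.log (V₀ ^ 2 / 2) := by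
    have := intervalIntegral.integral_mono_on zero_le_one (hc t ht)
      ((intervalIntegrable_const (μ := volume) (c := Real.log (V₀ ^ 2 / 2) - 1)).add hvint)
      fun x hx => by
        have h1 := Real.log_le_log (sol.θpos t ht x hx) (hlt x hx).le
        have h2 := Real.log_le_sub_one_of_pos (sol.vpos t ht x hx)
        change _ ≤ Real.log (V₀ ^ 2 / 2) - 1 + sol.v t x
        linarith
    rw [intervalIntegral.integral_add intervalIntegrable_const hvint,
      sol.integral_v_eq_one ht] at this
    simpa using this
  have hmono := sol.entropy_initial_le hχ ht
  have hlog : Real.log (V₀ ^ 2 / 2) < Real.log (V₀ ^ 2) :=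
    Real.log_lt_log (by positivity) (by linarith [pow_pos hV₀ 2])
  rw [Real.log_pow] at hlog
  push_cast at hlog
  linarith

/-- The dissipation `W(t)` controls the oscillation of `θ ^ (β / 2)`. -/
theorem rpow_temperature_sub_le (sol : NSAC α β (Icc 0 T)) (hβ : 0 < β) {t : ℝ}
    (ht : t ∈ Icc (0:ℝ) T) (hχ : ∀ x ∈ Icc (0:ℝ) 1, 0 < sol.χ t x) {ε : ℝ} (hε : 0 < ε)
    {x y : ℝ} (hx : x ∈ Icc (0:ℝ) 1) (hy : y ∈ Icc (0:ℝ) 1) :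
    sol.θ t y ^ (β / 2) - sol.θ t x ^ (β / 2) ≤ β / 4 * (ε * Wdiss sol t + ε⁻¹) := by
  have hθ := sol.θpos t ht
  have hv := sol.vpos t ht
  have cθ := (continuous_slice sol.smooth_θ t).continuousOn (s := Icc 0 1)
  have cv := (continuous_slice sol.smooth_v t).continuousOn (s := Icc 0 1)
  have cχ := (continuous_slice sol.smooth_χ t).continuousOn (s := Icc 0 1)
  have cθx := (continuous_slice (contDiff_pdx sol.smooth_θ) t).continuousOn (s := Icc 0 1)
  have cux := (continuous_slice (contDiff_pdx sol.smooth_u) t).continuousOn (s := Icc 0 1)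
  have cμ : ContinuousOn (sol.μ t) (Icc 0 1) := by
    refine ((continuous_slice (contDiff_pdt sol.smooth_χ) t).continuousOn.neg.div cv
      fun z hz => (hv z hz).ne').congr fun z hz => ?_
    have := hv z hz
    rw [Pi.div_apply, Pi.neg_apply, sol.eq_phase t ht z hz]
    field_simp
  have cW : ContinuousOn (fun z =>
      sol.θ t z ^ β * pdx sol.θ t z ^ 2 / (sol.v t z * sol.θ t z ^ 2)
      + sol.χ t z ^ α * pdx sol.u t z ^ 2 / (sol.v t z * sol.θ t z)
      + sol.v t z * sol.μ t z ^ 2 / sol.θ t z) (Icc 0 1) := by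
    refine (ContinuousOn.add ?_ ?_).add ?_
    · exact ((cθ.rpow_const fun z hz => Or.inl (hθ z hz).ne').mul (cθx.pow 2)).div
        (cv.mul (cθ.pow 2)) fun z hz => (mul_pos (hv z hz) (pow_pos (hθ z hz) 2)).ne'
    · exact ((cχ.rpow_const fun z hz => Or.inl (hχ z hz).ne').mul (cux.pow 2)).div
        (cv.mul cθ) fun z hz => (mul_pos (hv z hz) (hθ z hz)).ne'
    · exact (cv.mul (cμ.pow 2)).div cθ fun z hz => (hθ z hz).ne'
  have key := sub_le_integral_of_abs_deriv_le
    (fun z hz => (hasDerivAt_pdx sol.smooth_θ t z).rpow_const (p := β / 2)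
      (Or.inl (hθ z hz).ne'))
    (((cW.const_smul ε).add (cv.const_smul ε⁻¹)).const_smul (β / 4)) ?_ hx hy
  · refine key.trans_eq ?_
    simp only [Pi.add_apply, Pi.smul_apply, smul_eq_mul]
    rw [intervalIntegral.integral_const_mul, intervalIntegral.integral_add
      ((cW.intervalIntegrable_of_Icc zero_le_one).const_mul ε)
      ((cv.intervalIntegrable_of_Icc zero_le_one).const_mul ε⁻¹),
      intervalIntegral.integral_const_mul, intervalIntegral.integral_const_mul,
      sol.integral_v_eq_one ht, mul_one, Wdiss]
  intro z hz
  have hθz := hθ z hz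
  have hvz := hv z hz
  have hχα : 0 < sol.χ t z ^ α := Real.rpow_pos_of_pos (hχ z hz) α
  simp only [Pi.add_apply, Pi.smul_apply, smul_eq_mul]
  set r := sol.θ t z ^ (β / 2) with hr
  have hrpos : 0 < r := Real.rpow_pos_of_pos hθz _
  have hrr : sol.θ t z ^ β = r ^ 2 := by
    rw [hr, sq, ← Real.rpow_add hθz, add_halves]
  have hd : |pdx sol.θ t z * (β / 2) * sol.θ t z ^ (β / 2 - 1)|
      = β / 2 * (r * |pdx sol.θ t z| / sol.θ t z) := by
    rw [Real.rpow_sub_one hθz.ne', abs_mul, abs_mul, abs_of_pos (half_pos hβ),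
      abs_of_pos (div_pos hrpos hθz)]
    ring
  have hyoung : 2 * (r * |pdx sol.θ t z| / sol.θ t z)
      ≤ ε * (r ^ 2 * pdx sol.θ t z ^ 2 / (sol.v t z * sol.θ t z ^ 2)) + ε⁻¹ * sol.v t z := by
    have hsq : ε * (r ^ 2 * pdx sol.θ t z ^ 2 / (sol.v t z * sol.θ t z ^ 2)) + ε⁻¹ * sol.v t z
        - 2 * (r * |pdx sol.θ t z| / sol.θ t z)
        = (ε * (r * |pdx sol.θ t z| / sol.θ t z) - sol.v t z) ^ 2 / (ε * sol.v t z) := by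
      rw [← sq_abs (pdx sol.θ t z)]
      field_simp
      ring
    have : 0 ≤ (ε * (r * |pdx sol.θ t z| / sol.θ t z) - sol.v t z) ^ 2 / (ε * sol.v t z) := by
      positivity
    linarith
  have hrest : 0 ≤ ε * (sol.χ t z ^ α * pdx sol.u t z ^ 2 / (sol.v t z * sol.θ t z)
      + sol.v t z * sol.μ t z ^ 2 / sol.θ t z) := by positivity
  rw [hd, hrr]
  nlinarith

end NSAC

/-- Pointwise lower bound for the temperature in terms of the dissipation `W(t)`. -/
theorem stmt_6 (β V₀ M₀ : ℝ) (hβ : 0 < β) (hV₀ : 0 < V₀) (hM₀ : 0 < M₀) :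
    ∃ C₁ > (0:ℝ), ∃ C₂ > (0:ℝ),
      ∀ (α T m₁ m₂ m₃ N : ℝ), 0 ≤ α → 0 < T →
        m₁ ≤ 1 → m₂ ≤ 1 → m₃ ≤ 1 → 8 ≤ N →
        ∀ sol : XClass α β T m₁ m₂ m₃ N,
        InitData sol.toNSAC V₀ M₀ →
        ∀ t ∈ Icc (0:ℝ) T, ∀ x ∈ Icc (0:ℝ) 1,
          C₁ - C₂ * Wdiss sol.toNSAC t ≤ sol.toNSAC.θ t x := by
  set a : ℝ := V₀ ^ 2 / 2 with ha
  have hapos : 0 < a := by positivity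
  set d : ℝ := a ^ (β / 2) - (a / 2) ^ (β / 2) with hd
  have hdpos : 0 < d :=
    sub_pos.2 (Real.rpow_lt_rpow (by positivity) (half_lt_self hapos) (half_pos hβ))
  refine ⟨a / 2, half_pos hapos, a / 2 * (β ^ 2 / (4 * d ^ 2)), by positivity, ?_⟩
  intro α T m₁ m₂ m₃ N _ _ _ _ _ _ sol hinit t ht x hx
  have hχ : ∀ s ∈ Icc (0:ℝ) T, ∀ x ∈ Icc (0:ℝ) 1, 0 < sol.χ s x :=
    fun s hs x hx => sol.m₂pos.trans_le (sol.lb_χ s hs x hx)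
  obtain ⟨hv₀, -, hθ₀, -⟩ := hinit
  obtain ⟨y, hy, hay⟩ := sol.exists_le_temperature hχ hV₀ hv₀ hθ₀ ht
  have hθx := sol.θpos t ht x hx
  have hosc := sol.rpow_temperature_sub_le hβ ht (hχ t ht)
    (ε := β / (2 * d)) (by positivity) hx hy
  have hWnn : 0 ≤ Wdiss sol.toNSAC t :=
    intervalIntegral.integral_nonneg zero_le_one fun z hz => by
      have h1 := Real.rpow_pos_of_pos (hχ t ht z hz) α
      have h2 := sol.vpos t ht z hz
      have h3 := sol.θpos t ht z hz
      have h4 := Real.rpow_pos_of_pos h3 β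
      positivity
  rcases le_total (a / 2) (sol.θ t x) with hlarge | hsmall
  · have : 0 ≤ a / 2 * (β ^ 2 / (4 * d ^ 2)) * Wdiss sol.toNSAC t := by positivity
    linarith
  · have h1 : sol.θ t x ^ (β / 2) ≤ (a / 2) ^ (β / 2) :=
      Real.rpow_le_rpow hθx.le hsmall (half_pos hβ).le
    have h2 : a ^ (β / 2) ≤ sol.θ t y ^ (β / 2) :=
      Real.rpow_le_rpow hapos.le hay (half_pos hβ).le
    have h3 : d ≤ β / 4 * (β / (2 * d) * Wdiss sol.toNSAC t + (β / (2 * d))⁻¹) := by linarith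
    have h4 : β / 4 * (β / (2 * d) * Wdiss sol.toNSAC t + (β / (2 * d))⁻¹)
        = d / 2 * (β ^ 2 / (4 * d ^ 2) * Wdiss sol.toNSAC t + 1) := by
      field_simp
      ring
    have h5 : 1 ≤ β ^ 2 / (4 * d ^ 2) * Wdiss sol.toNSAC t := by
      by_contra! hlt
      rw [h4] at h3
      nlinarith
    nlinarith

end
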